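/- Let λ ≥ 2 be a cardinal, B⁰_λ(S) the topological Brandt λ⁰-extension of a topological monoid S with zero, T a topological semigroup, and h : B⁰_λ(S) → T a continuous homomorphism. Then for all α, β, γ, δ ∈ I_λ and all A ⊆ S, the sets h(A_{α,β}) and h(A_{γ,δ}) are homeomorphic subspaces of T, with a homeomorphism given by x ↦ h(γ,1_S,α)·x·h(β,1_S,δ). -/

import Mathlib

attribute [local instance] Classical.propDecidable

/-- The Brandt `λ⁰`-extension of a semigroup `S` with zero, with index set `I`:
its elements are `0` (encoded `none`) and triples `(α, s, β)` with `s ≠ 0`. -/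
def Brandt (I S : Type*) [Zero S] : Type _ := Option (I × {s : S // s ≠ 0} × I)

instance brandtZero {I S : Type*} [Zero S] : Zero (Brandt I S) := ⟨none⟩

/-- Multiplication on the Brandt `λ⁰`-extension. -/
noncomputable def brandtMul {I S : Type*} [Zero S] [Mul S] :
    Brandt I S → Brandt I S → Brandt I S
  | some (α, a, β), some (γ, b, δ) =>
      if h : β = γ ∧ a.1 * b.1 ≠ 0 then some (α, ⟨a.1 * b.1, h.2⟩, δ) else none
  | _, _ => none

noncomputable instance brandtMulInst {I S : Type*} [Zero S] [Mul S] :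
    Mul (Brandt I S) := ⟨brandtMul⟩

/-- The semigroup of `I × I`-matrix units. -/
def MatrixUnits (I : Type*) := Option (I × I)

instance muZero {I : Type*} : Zero (MatrixUnits I) := ⟨none⟩

noncomputable instance muMul {I : Type*} : Mul (MatrixUnits I) :=
  ⟨fun x y => match x, y with
    | some (a, b), some (c, d) => if b = c then some (a, d) else none
    | _, _ => none⟩

/-- The subset of `Brandt I S` induced by a subset `T ⊆ S`
(the Brandt extension of `T` inside that of `S`). -/
def brandtSet {I S : Type*} [Zero S] (T : Set S) : Set (Brandt I S) :=
  {z | z = 0 ∨ ∃ (α β : I) (s : {s : S // s ≠ 0}), s.1 ∈ T ∧ z = some (α, s, β)}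

/-- The map `B⁰_{λ₁}(S) → B⁰_{λ₂}(T)` induced by `h : S → T`, an index map `φ`
and families `u`, `v` (`v` playing the role of `a ↦ u(a)⁻¹`):
`(α,s,β) ↦ (φ α, u α · h s · v β, φ β)` when the middle entry is nonzero, else `0`. -/
noncomputable def brandtHomMap {I₁ I₂ S T : Type*} [Zero S] [Zero T] [Mul T]
    (φ : I₁ → I₂) (u v : I₁ → T) (h : S → T) : Brandt I₁ S → Brandt I₂ T
  | some (a, s, b) =>
      if hh : u a * h s.1 * v b ≠ 0 then
        some (φ a, ⟨u a * h s.1 * v b, hh⟩, φ b) else none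
  | none => none

/-- The canonical copy of `S` in `Brandt I S` at index `α` (the set `S_{α,α}`). -/
noncomputable def brandtIncl {I S : Type*} [Zero S] (α : I) : S → Brandt I S :=
  fun s => if h : s = 0 then 0 else some (α, ⟨s, h⟩, α)

/-- The non-zero element `(α, s, β)` of `Brandt I S`. -/
def brandtElt {I S : Type*} [Zero S] (α : I) (s : {s : S // s ≠ 0}) (β : I) :
    Brandt I S := some (α, s, β)

/-- The subset `A_{α,β}` of `Brandt I S` induced by `A ⊆ S`
(containing the zero exactly when `0 ∈ A`). -/
def brandtSetAB {I S : Type*} [Zero S] (A : Set S) (α β : I) : Set (Brandt I S) :=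
  {z | (z = 0 ∧ (0 : S) ∈ A) ∨ ∃ s : {s : S // s ≠ 0}, s.1 ∈ A ∧ z = brandtElt α s β}

theorem brandtElt_mul {I S : Type*} [MonoidWithZero S]
    (α β δ : I) (a b : {s : S // s ≠ 0}) (hab : a.1 * b.1 ≠ 0) :
    brandtElt α a β * brandtElt β b δ = brandtElt α ⟨a.1 * b.1, hab⟩ δ :=
  dif_pos (c := β = β ∧ a.1 * b.1 ≠ 0) ⟨rfl, hab⟩

theorem brandt_sandwich {I S : Type*} [MonoidWithZero S] (h1 : (1 : S) ≠ 0)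
    (α β γ δ : I) (s : {s : S // s ≠ 0}) :
    brandtElt γ ⟨1, h1⟩ α * brandtElt α s β * brandtElt β ⟨1, h1⟩ δ = brandtElt γ s δ := by
  have e1 : (1 : S) * s.1 ≠ 0 := by rw [one_mul]; exact s.2
  have e2 : s.1 * (1 : S) ≠ 0 := by rw [mul_one]; exact s.2
  have f1 : (⟨(1 : S) * s.1, e1⟩ : {s : S // s ≠ 0}) = s := Subtype.ext (one_mul _)
  have f2 : (⟨s.1 * (1 : S), e2⟩ : {s : S // s ≠ 0}) = s := Subtype.ext (mul_one _)
  rw [brandtElt_mul γ α β ⟨1, h1⟩ s e1, f1, brandtElt_mul γ β δ s ⟨1, h1⟩ e2, f2]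

theorem brandt_sandwich_zero {I S : Type*} [MonoidWithZero S]
    (x y : Brandt I S) : x * 0 * y = 0 := by
  change brandtMul (brandtMul x none) y = none
  rcases x with _ | ⟨a, b, c⟩ <;> rfl

theorem brandt_mapsTo {I S T : Type*} [MonoidWithZero S] [Mul T] (h1 : (1 : S) ≠ 0)
    (h : Brandt I S → T) (hm : ∀ x y, h (x * y) = h x * h y)
    (A : Set S) (α β γ δ : I) (x : T) (hx : x ∈ h '' brandtSetAB A α β) :
    h (brandtElt γ ⟨1, h1⟩ α) * x * h (brandtElt β ⟨1, h1⟩ δ) ∈ h '' brandtSetAB A γ δ := by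
  obtain ⟨z, hz, rfl⟩ := hx
  rw [← hm, ← hm]
  refine ⟨_, ?_, rfl⟩
  rcases hz with ⟨rfl, hA⟩ | ⟨s, hs, rfl⟩
  · exact Or.inl ⟨brandt_sandwich_zero _ _, hA⟩
  · exact Or.inr ⟨s, hs, brandt_sandwich h1 α β γ δ s⟩

theorem brandt_inv {I S T : Type*} [MonoidWithZero S] [Mul T] (h1 : (1 : S) ≠ 0)
    (h : Brandt I S → T) (hm : ∀ x y, h (x * y) = h x * h y)
    (A : Set S) (α β γ δ : I) (x : T) (hx : x ∈ h '' brandtSetAB A α β) :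
    h (brandtElt α ⟨1, h1⟩ γ) *
      (h (brandtElt γ ⟨1, h1⟩ α) * x * h (brandtElt β ⟨1, h1⟩ δ)) *
      h (brandtElt δ ⟨1, h1⟩ β) = x := by
  obtain ⟨z, hz, rfl⟩ := hx
  rw [← hm, ← hm, ← hm, ← hm]
  rcases hz with ⟨rfl, hA⟩ | ⟨s, hs, rfl⟩
  · rw [brandt_sandwich_zero, brandt_sandwich_zero]
  · rw [brandt_sandwich, brandt_sandwich]

/-- For a continuous homomorphism `h : B⁰_λ(S) → T` (`λ ≥ 2`), the
sets `h(A_{α,β})` and `h(A_{γ,δ})` are homeomorphic via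
`x ↦ h(γ,1,α)·x·h(β,1,δ)`. -/
theorem brandt_images_homeomorphic {I S T : Type*} [MonoidWithZero S]
    [TopologicalSpace S] [ContinuousMul S] [Nontrivial I]
    [TopologicalSpace (Brandt I S)] [ContinuousMul (Brandt I S)]
    [TopologicalSpace T] [Mul T] [ContinuousMul T]
    (h1 : (1 : S) ≠ 0)
    (α₀ : I) (hemb : Topology.IsEmbedding (brandtIncl (I := I) (S := S) α₀))
    (h : Brandt I S → T) (hm : ∀ x y, h (x * y) = h x * h y) (hc : Continuous h)
    (A : Set S) (α β γ δ : I) :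
    ∃ e : (h '' brandtSetAB A α β) ≃ₜ (h '' brandtSetAB A γ δ),
      ∀ x : h '' brandtSetAB A α β,
        (e x : T) = h (brandtElt γ ⟨1, h1⟩ α) * (x : T) * h (brandtElt β ⟨1, h1⟩ δ) := by
  exact ⟨{
    toFun := fun x => ⟨_, brandt_mapsTo h1 h hm A α β γ δ x.1 x.2⟩
    invFun := fun x => ⟨_, brandt_mapsTo h1 h hm A γ δ α β x.1 x.2⟩
    left_inv := fun x => Subtype.ext (brandt_inv h1 h hm A α β γ δ x.1 x.2)
    right_inv := fun x => Subtype.ext (brandt_inv h1 h hm A γ δ α β x.1 x.2)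
    continuous_toFun := by
      refine Continuous.subtype_mk ?_ _
      exact (continuous_const.mul continuous_subtype_val).mul continuous_const
    continuous_invFun := by
      refine Continuous.subtype_mk ?_ _
      exact (continuous_const.mul continuous_subtype_val).mul continuous_const }, fun x => rfl⟩
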